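/- arXiv:2401.09165 — 2 statements merged into one kernel-verified Lean document; each statement's English description precedes it below -/
import Mathlib

section
/- Bernstein-type inequality for anisotropic Fourier support: for every k ∈ ℕ there exists a constant C = C(k) > 0 (depending also on the anisotropic structure but NOT on λ) such that for every λ > 0, every block index i ∈ {0,…,r}, and every smooth bounded function f : ℝ^N → ℝ whose distributional Fourier transform is supported in the anisotropic ball 𝐁_λ (i.e. ∫_{ℝ^N} f(z) (ℱφ)(z) dz = 0 for every Schwartz function φ with supp φ ∩ 𝐁_λ = ∅, where ℱφ(z) = (2π)^{−N/2}∫ e^{−i⟨z,ξ⟩}φ(ξ)dξ), one has Σ_{l=d̄_{i−1}+1}^{d̄_i} sup_{z∈ℝ^N} |∂^k_{z_l} f(z)| ≤ C λ^{(2i+1)k} sup_{z∈ℝ^N}|f(z)|. -/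
open MeasureTheory Real Filter Matrix
open scoped ENNReal

noncomputable section

/-- Index type for `ℝ^N` split into blocks: coordinate `⟨i, l⟩` lies in block `i`. -/
abbrev Idx (r : ℕ) (d : Fin (r+1) → ℕ) := (i : Fin (r+1)) × Fin (d i)

/-- Euclidean norm of the `i`-th block of `z`. -/
def blockNorm (r : ℕ) (d : Fin (r+1) → ℕ) (z : Idx r d → ℝ) (i : Fin (r+1)) : ℝ :=
  Real.sqrt (∑ l : Fin (d i), z ⟨i, l⟩ ^ 2)

/-- Anisotropic norm `|z|_B = Σ_i |z_i|^{1/(2i+1)}`. -/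
def anisoNorm (r : ℕ) (d : Fin (r+1) → ℕ) (z : Idx r d → ℝ) : ℝ :=
  ∑ i : Fin (r+1), blockNorm r d z i ^ ((1 : ℝ) / (2 * ((i : ℕ) : ℝ) + 1))

/-- Closed anisotropic ball `𝐁_τ` of radius `τ` centred at the origin. -/
def anisoBall (r : ℕ) (d : Fin (r+1) → ℕ) (τ : ℝ) : Set (Idx r d → ℝ) :=
  {ξ | anisoNorm r d ξ ≤ τ}

/-- Fourier transform `ℱφ(z) = (2π)^{-N/2} ∫ e^{-i⟨z,ξ⟩} φ(ξ) dξ`. -/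
def fourierT (r : ℕ) (d : Fin (r+1) → ℕ) (φ : (Idx r d → ℝ) → ℝ) (z : Idx r d → ℝ) : ℂ :=
  (((2 * π) ^ (-(Fintype.card (Idx r d) : ℝ) / 2) : ℝ) : ℂ) *
    ∫ ξ : Idx r d → ℝ, Complex.exp (-Complex.I * ((∑ l, z l * ξ l : ℝ) : ℂ)) * (φ ξ : ℂ)

/-- Partial derivative along the coordinate `l`. -/
def pd (r : ℕ) (d : Fin (r+1) → ℕ) (l : Idx r d) (f : (Idx r d → ℝ) → ℝ) :
    (Idx r d → ℝ) → ℝ :=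
  fun z => fderiv ℝ f z (Pi.single l 1)

open scoped FourierTransform SchwartzMap LineDeriv Convolution ContDiff

/-- Complex-valued Schwartz function with the values of a real-valued one. -/
def SchwartzMap.complexify {D : Type*} [NormedAddCommGroup D] [NormedSpace ℝ D] (φ : 𝓢(D, ℝ)) :
    𝓢(D, ℂ) :=
  φ.postcompCLM Complex.ofRealCLM

lemma SchwartzMap.eq_complexify_add {D : Type*} [NormedAddCommGroup D] [NormedSpace ℝ D]
    (Φ : 𝓢(D, ℂ)) :
    Φ = (Φ.postcompCLM Complex.reCLM).complexify +
      Complex.I • (Φ.postcompCLM Complex.imCLM).complexify := by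
  ext x
  simp [SchwartzMap.complexify, mul_comm Complex.I, Complex.re_add_im]

lemma contDiff_iterate_fderiv_apply {E F : Type*} [NormedAddCommGroup E] [NormedSpace ℝ E]
    [NormedAddCommGroup F] [NormedSpace ℝ F] {u : E → F} (hu : ContDiff ℝ ∞ u) (v : E) (k : ℕ) :
    ContDiff ℝ ∞ ((fun w : E → F ↦ fun y ↦ fderiv ℝ w y v)^[k] u) := by
  induction k with
  | zero => exact hu
  | succ k ih =>
    rw [Function.iterate_succ_apply']
    exact (ih.fderiv_right (m := ∞) (by simp)).clm_apply contDiff_const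

section Core

variable {E : Type*} [NormedAddCommGroup E] [InnerProductSpace ℝ E] [FiniteDimensional ℝ E]
  [MeasurableSpace E] [BorelSpace E]

lemma SchwartzMap.integrable_bdd_mul {u : E → ℂ} (hu : Continuous u) {M : ℝ}
    (hM : ∀ x, ‖u x‖ ≤ M) (g : 𝓢(E, ℂ)) : Integrable (fun x ↦ u x * g x) :=
  g.integrable.bdd_mul hu.aestronglyMeasurable (ae_of_all _ hM)

/-- Convolution with a Schwartz function commutes with directional derivatives. -/
lemma SchwartzMap.convolution_lineDerivOp (h g : 𝓢(E, ℂ)) (v : E) :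
    SchwartzMap.convolution (.mul ℂ ℂ) h (∂_{v} g) =
      SchwartzMap.convolution (.mul ℂ ℂ) (∂_{v} h) g := by
  have H : (inner ℝ · v : E → ℝ).HasTemperateGrowth := by fun_prop
  have inj : Function.Injective fun φ : 𝓢(E, ℂ) ↦ (𝓕 φ : 𝓢(E, ℂ)) :=
    Function.LeftInverse.injective (g := fun φ : 𝓢(E, ℂ) ↦ (𝓕⁻ φ : 𝓢(E, ℂ)))
      fun φ ↦ FourierTransform.fourierInv_fourier_eq φ
  apply inj
  ext x
  simp only [SchwartzMap.fourier_convolution, SchwartzMap.pairing_apply_apply,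
    SchwartzMap.fourier_lineDerivOp_eq, _root_.smul_apply,
    SchwartzMap.smulLeftCLM_apply_apply H, ContinuousLinearMap.mul_apply', smul_eq_mul,
    Complex.real_smul]
  ring

lemma SchwartzMap.convolution_iterate_lineDerivOp (h g : 𝓢(E, ℂ)) (v : E) (k : ℕ) :
    SchwartzMap.convolution (.mul ℂ ℂ) h ((fun φ : 𝓢(E, ℂ) ↦ ∂_{v} φ)^[k] g) =
      SchwartzMap.convolution (.mul ℂ ℂ) ((fun φ : 𝓢(E, ℂ) ↦ ∂_{v} φ)^[k] h) g := by
  induction k generalizing h with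
  | zero => rfl
  | succ k ih =>
    rw [Function.iterate_succ_apply', SchwartzMap.convolution_lineDerivOp, ih,
      ← Function.iterate_succ_apply (fun φ : 𝓢(E, ℂ) ↦ ∂_{v} φ)]

/-- Young's inequality, tested against a bounded function. -/
lemma SchwartzMap.norm_integral_mul_convolution_le {u : E → ℂ} {M : ℝ}
    (hM : ∀ x, ‖u x‖ ≤ M) (h g : 𝓢(E, ℂ)) :
    ‖∫ x, u x * SchwartzMap.convolution (.mul ℂ ℂ) h g x‖ ≤
      M * ((∫ x, ‖h x‖) * ∫ x, ‖g x‖) := by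
  have hint := h.integrable.norm.integrable_convolution (.mul ℝ ℝ) (g.integrable (μ := volume)).norm
  have hM0 : 0 ≤ M := (norm_nonneg _).trans (hM 0)
  calc _ ≤ ∫ x, M * ((fun y ↦ ‖h y‖) ⋆[.mul ℝ ℝ] (fun y ↦ ‖g y‖)) x := by
        refine norm_integral_le_of_norm_le (hint.const_mul M) (ae_of_all _ fun x ↦ ?_)
        rw [norm_mul, SchwartzMap.convolution_apply]
        refine mul_le_mul (hM x) ?_ (norm_nonneg _) hM0
        refine (norm_integral_le_integral_norm _).trans_eq ?_
        simp [MeasureTheory.convolution]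
    _ = _ := by
        rw [integral_const_mul, integral_convolution _ h.integrable.norm g.integrable.norm]
        rfl

/-- Iterated integration by parts against a compactly supported function. -/
lemma integral_iterate_fderiv_mul (u : E → ℂ) (hu : ContDiff ℝ ∞ u) (v : E) (k : ℕ) (g : 𝓢(E, ℂ))
    (hg : HasCompactSupport g) :
    ∫ x, (fun w : E → ℂ ↦ fun y ↦ fderiv ℝ w y v)^[k] u x * g x =
      (-1) ^ k * ∫ x, u x * ((fun φ : 𝓢(E, ℂ) ↦ ∂_{v} φ)^[k] g) x := by
  induction k generalizing u g with
  | zero => simp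
  | succ k ih =>
    have hu1 : ContDiff ℝ ∞ fun y ↦ fderiv ℝ u y v :=
      (hu.fderiv_right (m := ∞) (by simp)).clm_apply contDiff_const
    have hsupp : ∀ (j : ℕ), HasCompactSupport ((fun φ : 𝓢(E, ℂ) ↦ ∂_{v} φ)^[j] g) := by
      intro j
      induction j with
      | zero => exact hg
      | succ j ihj =>
        rw [Function.iterate_succ_apply']
        exact ihj.mono' ((subset_tsupport _).trans (SchwartzMap.tsupport_lineDerivOp_subset v _))
    rw [Function.iterate_succ_apply, ih _ hu1 g hg, Function.iterate_succ_apply', pow_succ]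
    set G := (fun φ : 𝓢(E, ℂ) ↦ ∂_{v} φ)^[k] g
    have hint : ∀ (w : E → ℂ) (φ : 𝓢(E, ℂ)), Continuous w → HasCompactSupport φ →
        Integrable fun x ↦ w x * φ x := fun w φ hw hφ ↦
      (hw.mul φ.continuous).integrable_of_hasCompactSupport hφ.mul_left
    have hG' : HasCompactSupport (∂_{v} G : 𝓢(E, ℂ)) := by
      simpa [Function.iterate_succ_apply'] using hsupp (k + 1)
    have := integral_mul_fderiv_eq_neg_fderiv_mul_of_integrable (f := u) (g := G) (v := v)
      (μ := volume) (hint _ G hu1.continuous (hsupp k))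
      (hint u (∂_{v} G : 𝓢(E, ℂ)) hu.continuous hG')
      (hint u G hu.continuous (hsupp k))
      (fun x _ ↦ hu.differentiable (by simp) x) (fun x _ ↦ G.differentiableAt)
    simp only [SchwartzMap.lineDerivOp_apply_eq_fderiv] at *
    rw [this]
    ring

/-- A continuous function that is bounded by `A` as a functional on `L¹` is bounded by `A`. -/
lemma norm_le_of_norm_integral_mul_le {u : E → ℂ} (hu : Continuous u) {A : ℝ}
    (hA : ∀ g : 𝓢(E, ℂ), HasCompactSupport g → ‖∫ x, u x * g x‖ ≤ A * ∫ x, ‖g x‖) (x : E) :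
    ‖u x‖ ≤ A := by
  let φ : ℕ → ContDiffBump (0 : E) := fun n ↦
    ⟨1 / (n + 1 : ℝ), 2 / (n + 1 : ℝ), by positivity, by gcongr; norm_num⟩
  have hφ : Tendsto (fun n ↦ (φ n).rOut) atTop (nhds 0) := by
    simpa [φ, div_eq_mul_inv] using
      (tendsto_one_div_add_atTop_nhds_zero_nat (𝕜 := ℝ)).const_mul 2
  refine le_of_tendsto
    (ContDiffBump.convolution_tendsto_right_of_continuous (μ := volume) hφ hu x).norm
    (Eventually.of_forall fun n ↦ ?_)
  let G : E → ℂ := fun y ↦ ((φ n).normed volume (x - y) : ℂ)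
  have hG1 : ContDiff ℝ ∞ G :=
    Complex.ofRealCLM.contDiff.comp ((φ n).contDiff_normed.comp (contDiff_const.sub contDiff_id))
  have hG2 : HasCompactSupport G :=
    (((φ n).hasCompactSupport_normed (μ := volume)).comp_homeomorph
      (Homeomorph.subLeft x)).comp_left (g := Complex.ofReal) (by simp)
  have key := hA (hG2.toSchwartzMap hG1) hG2
  have h1 : ∫ y, ‖G y‖ = 1 := by
    have : ∀ y, ‖G y‖ = (φ n).normed volume (x - y) := fun y ↦ by
      simp [G, abs_of_nonneg ((φ n).nonneg_normed _)]
    simp_rw [this]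
    rw [integral_sub_left_eq_self (fun y ↦ (φ n).normed volume y), (φ n).integral_normed]
  have h2 : ((φ n).normed volume ⋆[.lsmul ℝ ℝ, volume] u) x = ∫ y, u y * G y := by
    rw [convolution_eq_swap]
    simp [G, mul_comm]
  rw [h2]
  simpa [h1] using key

/-- Bernstein's inequality for functions whose spectrum lies in a fixed ball. -/
lemma exists_bernstein_of_spectrum_subset_ball (R : ℝ) (hR : 0 < R) (v : E) (k : ℕ) :
    ∃ C : ℝ, 0 ≤ C ∧ ∀ u : E → ℂ, ContDiff ℝ ∞ u →
      (∀ Φ : 𝓢(E, ℝ), (∀ x, ‖x‖ < R → Φ x = 0) → ∫ x, u x * 𝓕 Φ.complexify x = 0) →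
      ∀ M : ℝ, (∀ x, ‖u x‖ ≤ M) →
      ∀ x, ‖(fun w : E → ℂ ↦ fun y ↦ fderiv ℝ w y v)^[k] u x‖ ≤ C * M := by
  let χ : ContDiffBump (0 : E) := ⟨R, 2 * R, hR, by linarith⟩
  have hχ : HasCompactSupport fun y ↦ (χ y : ℂ) :=
    χ.hasCompactSupport.comp_left (g := Complex.ofReal) (by simp)
  let m : 𝓢(E, ℂ) := hχ.toSchwartzMap (Complex.ofRealCLM.contDiff.comp χ.contDiff)
  have hm : ∀ y, m y = (χ y : ℂ) := fun _ ↦ rfl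
  let h : 𝓢(E, ℂ) := 𝓕⁻ m
  let H : 𝓢(E, ℂ) := (fun φ : 𝓢(E, ℂ) ↦ ∂_{v} φ)^[k] h
  refine ⟨∫ x, ‖H x‖, integral_nonneg fun _ ↦ norm_nonneg _, fun u hu hspec M hM x ↦ ?_⟩
  have hint := fun φ ↦ SchwartzMap.integrable_bdd_mul hu.continuous hM φ
  have hspec' : ∀ Φ : 𝓢(E, ℂ), (∀ x, ‖x‖ < R → Φ x = 0) → ∫ x, u x * 𝓕 Φ x = 0 := by
    intro Φ hΦ
    set Φ₁ := Φ.postcompCLM Complex.reCLM with hΦ₁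
    set Φ₂ := Φ.postcompCLM Complex.imCLM with hΦ₂
    have e1 := hspec Φ₁ fun x hx ↦ by simp [hΦ₁, hΦ x hx]
    have e2 := hspec Φ₂ fun x hx ↦ by simp [hΦ₂, hΦ x hx]
    have : ∀ x, u x * 𝓕 Φ x =
        u x * 𝓕 Φ₁.complexify x + Complex.I * (u x * 𝓕 Φ₂.complexify x) := by
      intro x
      rw [SchwartzMap.eq_complexify_add Φ, FourierTransform.fourier_add,
        FourierTransform.fourier_smul]
      simp only [_root_.add_apply, _root_.smul_apply, smul_eq_mul, ← hΦ₁, ← hΦ₂]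
      ring
    simp_rw [this]
    rw [integral_add (hint _) ((hint _).const_mul _), integral_const_mul, e1, e2]
    simp
  have hrep : ∀ g : 𝓢(E, ℂ), ∫ x, u x * g x =
      ∫ x, u x * SchwartzMap.convolution (.mul ℂ ℂ) h g x := by
    intro g
    have := hspec' (𝓕⁻ (g - SchwartzMap.convolution (.mul ℂ ℂ) h g)) fun x hx ↦ by
      have hx' : χ (-x) = 1 := χ.one_of_mem_closedBall (by simpa [χ] using hx.le)
      rw [SchwartzMap.fourierInv_apply_eq, SchwartzMap.compCLMOfContinuousLinearEquiv_apply]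
      simp [sub_eq_add_neg, FourierTransform.fourier_add, FourierTransform.fourier_neg,
        SchwartzMap.fourier_convolution, h, hm, hx']
    rw [FourierTransform.fourier_fourierInv_eq] at this
    simp only [_root_.sub_apply, mul_sub] at this
    rwa [integral_sub (hint _) (hint _), sub_eq_zero] at this
  refine norm_le_of_norm_integral_mul_le (contDiff_iterate_fderiv_apply hu v k).continuous
    (fun g hg ↦ ?_) x
  rw [integral_iterate_fderiv_mul u hu v k g hg, hrep, SchwartzMap.convolution_iterate_lineDerivOp]
  have := SchwartzMap.norm_integral_mul_convolution_le hM H g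
  simpa [mul_comm, mul_assoc, mul_left_comm] using this

end Core

/-- The diagonal scaling with nonzero weights `a`, as a map to Euclidean space. -/
def diagScaling {ι : Type*} [Fintype ι] (a : ι → ℝ) (ha : ∀ l, a l ≠ 0) :
    (ι → ℝ) ≃L[ℝ] EuclideanSpace ℝ ι :=
  (ContinuousLinearEquiv.piCongrRight fun l ↦
    ContinuousLinearEquiv.unitsEquivAut ℝ (Units.mk0 (a l) (ha l))).trans
    (EuclideanSpace.equiv ι ℝ).symm

lemma diagScaling_apply {ι : Type*} [Fintype ι] (a : ι → ℝ) (ha : ∀ l, a l ≠ 0) (z : ι → ℝ)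
    (l : ι) : diagScaling a ha z l = a l * z l := by
  simp [diagScaling, mul_comm]

lemma diagScaling_single {ι : Type*} [Fintype ι] [DecidableEq ι] (a : ι → ℝ) (ha : ∀ l, a l ≠ 0)
    (l : ι) : diagScaling a ha (Pi.single l 1) = a l • EuclideanSpace.single l (1 : ℝ) := by
  ext j
  rw [diagScaling_apply]
  by_cases h : j = l
  · subst h; simp
  · simp [h]

lemma ContinuousLinearEquiv.exists_integral_comp_eq_mul {D E : Type*}
    [NormedAddCommGroup D] [NormedSpace ℝ D] [MeasureSpace D] [BorelSpace D]
    [(volume : Measure D).IsAddHaarMeasure]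
    [NormedAddCommGroup E] [NormedSpace ℝ E] [FiniteDimensional ℝ E] [MeasureSpace E]
    [BorelSpace E] [(volume : Measure E).IsAddHaarMeasure] (L : D ≃L[ℝ] E) :
    ∃ c : ℂ, c ≠ 0 ∧ ∀ g : E → ℂ, ∫ z, g (L z) = c * ∫ x, g x := by
  have hL : (Measure.map L (volume : Measure D)).IsAddHaarMeasure := L.isAddHaarMeasure_map _
  refine ⟨(Measure.addHaarScalarFactor (Measure.map L (volume : Measure D)) volume : ℝ),
    ?_, fun g ↦ ?_⟩
  · exact_mod_cast (Measure.addHaarScalarFactor_pos_of_isAddHaarMeasure _ _).ne'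
  · have h1 : ∫ z, g (L z) = ∫ x, g x ∂(Measure.map L (volume : Measure D)) :=
      (integral_map_equiv L.toHomeomorph.toMeasurableEquiv g).symm
    refine h1.trans ((congrArg (fun μ ↦ ∫ x, g x ∂μ)
      (Measure.isAddLeftInvariant_eq_smul (Measure.map L (volume : Measure D)) volume)).trans ?_)
    simp only [integral_smul_nnreal_measure]
    simp [NNReal.smul_def]

/-- `fourierT` of a rescaled Schwartz function in terms of the Fourier transform on Euclidean
space. -/
lemma exists_fourierT_diagScaling_eq (r : ℕ) (d : Fin (r+1) → ℕ) (a b : Idx r d → ℝ)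
    (ha : ∀ l, a l ≠ 0) (hb : ∀ l, b l ≠ 0) (hab : ∀ l, 2 * π * (a l * b l) = 1) :
    ∃ c : ℂ, c ≠ 0 ∧ ∀ (Φ : 𝓢(EuclideanSpace ℝ (Idx r d), ℝ)) (z : Idx r d → ℝ),
      fourierT r d (fun ξ ↦ Φ (diagScaling b hb ξ)) z =
        c * 𝓕 Φ.complexify (diagScaling a ha z) := by
  obtain ⟨c, hc, h⟩ := (diagScaling b hb).exists_integral_comp_eq_mul
  refine ⟨(((2 * π) ^ (-(Fintype.card (Idx r d) : ℝ) / 2) : ℝ) : ℂ) * c,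
    mul_ne_zero (by exact_mod_cast (by positivity : (0:ℝ) < _).ne') hc, fun Φ z ↦ ?_⟩
  rw [fourierT, mul_assoc, SchwartzMap.fourier_coe, Real.fourier_eq', ← h]
  congr 2
  ext ξ
  have hin : inner ℝ (diagScaling b hb ξ) (diagScaling a ha z) * (2 * π) = ∑ l, z l * ξ l := by
    simp only [PiLp.inner_apply, diagScaling_apply, Finset.sum_mul]
    refine Finset.sum_congr rfl fun l _ ↦ ?_
    simp only [RCLike.inner_apply, conj_trivial]
    linear_combination (z l * ξ l) * hab l
  rw [← hin]
  simp only [SchwartzMap.complexify, SchwartzMap.postcompCLM_apply, Complex.ofRealCLM_apply,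
    smul_eq_mul]
  congr 2
  push_cast
  ring

lemma abs_le_pow_of_mem_anisoBall (r : ℕ) (d : Fin (r+1) → ℕ) {lam : ℝ}
    {ξ : Idx r d → ℝ} (hξ : ξ ∈ anisoBall r d lam) (l : Idx r d) :
    |ξ l| ≤ lam ^ (2 * (l.1 : ℕ) + 1) := by
  obtain ⟨i, j⟩ := l
  have hnn : ∀ i, 0 ≤ blockNorm r d ξ i := fun i ↦ Real.sqrt_nonneg _
  have h1 : blockNorm r d ξ i ^ ((1 : ℝ) / (2 * ((i : ℕ) : ℝ) + 1)) ≤ lam :=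
    (Finset.single_le_sum (f := fun i : Fin (r+1) ↦
      blockNorm r d ξ i ^ ((1 : ℝ) / (2 * ((i : ℕ) : ℝ) + 1)))
      (fun i _ ↦ Real.rpow_nonneg (hnn i) _) (Finset.mem_univ i)).trans hξ
  have h2 : blockNorm r d ξ i ≤ lam ^ (2 * (i : ℕ) + 1) := by
    have h3 := pow_le_pow_left₀ (Real.rpow_nonneg (hnn i) _) h1 (2 * (i : ℕ) + 1)
    rwa [one_div, ← Real.rpow_natCast, ← Real.rpow_mul (hnn i), Nat.cast_add, Nat.cast_mul,
      Nat.cast_ofNat, Nat.cast_one, inv_mul_cancel₀ (by positivity), Real.rpow_one] at h3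
  refine le_trans ?_ h2
  rw [← Real.sqrt_sq_eq_abs]
  exact Real.sqrt_le_sqrt (Finset.single_le_sum (f := fun j ↦ ξ ⟨i, j⟩ ^ 2)
    (fun _ _ ↦ sq_nonneg _) (Finset.mem_univ j))

lemma disjoint_tsupport_comp_diagScaling_anisoBall (r : ℕ) (d : Fin (r+1) → ℕ) {lam : ℝ}
    (b : Idx r d → ℝ) (hb : ∀ l, b l ≠ 0) (hbl : ∀ l, |b l| * lam ^ (2 * (l.1 : ℕ) + 1) ≤ 1)
    (Φ : EuclideanSpace ℝ (Idx r d) → ℝ)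
    (hΦ : ∀ x, ‖x‖ < √(Fintype.card (Idx r d)) + 1 → Φ x = 0) :
    Disjoint (tsupport fun ξ ↦ Φ (diagScaling b hb ξ)) (anisoBall r d lam) := by
  rw [Set.disjoint_right]
  intro ξ hξ
  rw [notMem_tsupport_iff_eventuallyEq]
  have hlt : ‖diagScaling b hb ξ‖ < √(Fintype.card (Idx r d)) + 1 := by
    refine lt_of_le_of_lt ?_ (lt_add_one _)
    rw [EuclideanSpace.norm_eq]
    refine Real.sqrt_le_sqrt ?_
    calc _ ≤ ∑ _l : Idx r d, (1 : ℝ) := Finset.sum_le_sum fun l _ ↦ by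
          rw [diagScaling_apply, Real.norm_eq_abs, sq_abs, sq_le_one_iff_abs_le_one, abs_mul]
          exact (mul_le_mul_of_nonneg_left (abs_le_pow_of_mem_anisoBall r d hξ l)
            (abs_nonneg _)).trans (hbl l)
      _ = _ := by simp
  have hopen := ((diagScaling b hb).continuous.norm).continuousAt.eventually_lt_const hlt
  filter_upwards [hopen] with η hη using hΦ _ hη

/-- Chain rule for iterated partial derivatives under a diagonal scaling. -/
lemma iterate_pd_eq_of_comp_diagScaling (r : ℕ) (d : Fin (r+1) → ℕ) (l : Idx r d)
    (a : Idx r d → ℝ) (ha : ∀ l, a l ≠ 0) {f : (Idx r d → ℝ) → ℝ} (hf : ContDiff ℝ ∞ f)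
    {u : EuclideanSpace ℝ (Idx r d) → ℂ} (hu : ContDiff ℝ ∞ u)
    (huf : ∀ z, (f z : ℂ) = u (diagScaling a ha z)) (k : ℕ) (z : Idx r d → ℝ) :
    (((pd r d l)^[k] f z : ℝ) : ℂ) = (a l : ℂ) ^ k *
      (fun w : EuclideanSpace ℝ (Idx r d) → ℂ ↦
        fun y ↦ fderiv ℝ w y (EuclideanSpace.single l 1))^[k] u (diagScaling a ha z) := by
  induction k generalizing z with
  | zero => simpa using huf z
  | succ k ih =>
    rw [Function.iterate_succ_apply', Function.iterate_succ_apply']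
    have hF : ContDiff ℝ ∞ ((pd r d l)^[k] f) :=
      contDiff_iterate_fderiv_apply hf (Pi.single l (1 : ℝ)) k
    have hU := contDiff_iterate_fderiv_apply hu (EuclideanSpace.single l (1 : ℝ)) k
    set U := (fun w : EuclideanSpace ℝ (Idx r d) → ℂ ↦
        fun y ↦ fderiv ℝ w y (EuclideanSpace.single l 1))^[k] u
    have e1 := Complex.ofRealCLM.hasFDerivAt.comp z (hF.differentiable (by simp) z).hasFDerivAt
    have e2 := (((hU.differentiable (by simp) (diagScaling a ha z)).hasFDerivAt.comp z
      (diagScaling a ha).hasFDerivAt).const_smul ((a l : ℂ) ^ k))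
    have e3 := DFunLike.congr_fun (e1.unique (e2.congr_of_eventuallyEq
      (Eventually.of_forall fun y ↦ by simpa using ih y))) (Pi.single l 1)
    simp only [ContinuousLinearMap.comp_apply, Complex.ofRealCLM_apply, _root_.smul_apply,
      ContinuousLinearEquiv.coe_coe, diagScaling_single, map_smul, smul_eq_mul,
      Complex.real_smul] at e3
    rw [pd, e3]
    ring

/-- **Bernstein-type inequality for anisotropic Fourier support.**
For every `k` there is `C = C(k) > 0` (independent of `λ`) such that for every `λ > 0`,
every block index `i`, and every smooth bounded `f` whose distributional Fourier transform
is supported in the anisotropic ball `𝐁_λ`, one has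
`Σ_{l ∈ block i} sup_z |∂^k_{z_l} f(z)| ≤ C λ^{(2i+1)k} sup_z |f(z)|`
(the suprema being expressed through arbitrary bounds `M` and arbitrary evaluation points). -/
theorem bernstein_anisotropic
    (r : ℕ) (d : Fin (r+1) → ℕ) (hd1 : ∀ i, 1 ≤ d i) (hdmono : Antitone d) (k : ℕ) :
    ∃ C > (0:ℝ), ∀ lam > (0:ℝ), ∀ i : Fin (r+1), ∀ f : (Idx r d → ℝ) → ℝ,
      ContDiff ℝ (⊤ : ℕ∞) f →
      (∀ φ : SchwartzMap (Idx r d → ℝ) ℝ,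
        Disjoint (tsupport ⇑φ) (anisoBall r d lam) →
        (∫ z : Idx r d → ℝ, (f z : ℂ) * fourierT r d (⇑φ) z) = 0) →
      ∀ M : ℝ, (∀ z, |f z| ≤ M) →
      ∀ zs : Fin (d i) → (Idx r d → ℝ),
        ∑ l : Fin (d i), |(pd r d ⟨i, l⟩)^[k] f (zs l)|
          ≤ C * lam ^ ((2 * (i : ℕ) + 1) * k) * M := by
  choose C hC0 hC using fun l : Idx r d ↦ exists_bernstein_of_spectrum_subset_ball
    (√(Fintype.card (Idx r d)) + 1) (by positivity) (EuclideanSpace.single l (1 : ℝ)) k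
  have hCsum : 0 ≤ ∑ l, C l := Finset.sum_nonneg fun l _ ↦ hC0 l
  refine ⟨(1 / (2 * π)) ^ k * (∑ l, C l + 1), by positivity,
    fun lam hlam i f hf hspec M hM zs ↦ ?_⟩
  have hM0 : 0 ≤ M := (abs_nonneg _).trans (hM 0)
  let a : Idx r d → ℝ := fun l ↦ lam ^ (2 * (l.1 : ℕ) + 1) / (2 * π)
  let b : Idx r d → ℝ := fun l ↦ (lam ^ (2 * (l.1 : ℕ) + 1))⁻¹
  have ha : ∀ l, a l ≠ 0 := fun l ↦ by positivity
  have hb : ∀ l, b l ≠ 0 := fun l ↦ by positivity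
  obtain ⟨c, hc, hT⟩ := exists_fourierT_diagScaling_eq r d a b ha hb fun l ↦ by
    simp only [a, b]; field_simp
  obtain ⟨c', hc', hcv⟩ := (diagScaling a ha).exists_integral_comp_eq_mul
  let u : EuclideanSpace ℝ (Idx r d) → ℂ := fun x ↦ (f ((diagScaling a ha).symm x) : ℂ)
  have hu : ContDiff ℝ ∞ u :=
    Complex.ofRealCLM.contDiff.comp (hf.comp (diagScaling a ha).symm.contDiff)
  have huf : ∀ z, (f z : ℂ) = u (diagScaling a ha z) := fun z ↦ by simp [u]
  have hbound : ∀ l x, ‖(fun w : EuclideanSpace ℝ (Idx r d) → ℂ ↦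
        fun y ↦ fderiv ℝ w y (EuclideanSpace.single l 1))^[k] u x‖ ≤ C l * M := fun l ↦ by
    refine hC l u hu (fun Φ hΦ ↦ ?_) M fun x ↦ by simpa [u] using hM _
    have h0 := hspec (SchwartzMap.compCLMOfContinuousLinearEquiv ℝ (diagScaling b hb) Φ)
      (disjoint_tsupport_comp_diagScaling_anisoBall r d b hb (fun l ↦ by
        rw [abs_of_pos (by positivity), inv_mul_cancel₀ (by positivity)]) Φ hΦ)
    have h1 : ∀ z, (f z : ℂ) * fourierT r d
        (SchwartzMap.compCLMOfContinuousLinearEquiv ℝ (diagScaling b hb) Φ) z =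
        c * (fun x ↦ u x * 𝓕 Φ.complexify x) (diagScaling a ha z) := fun z ↦ by
      change (f z : ℂ) * fourierT r d (fun ξ ↦ Φ (diagScaling b hb ξ)) z = _
      rw [hT, huf]
      ring
    rw [integral_congr_ae (ae_of_all _ h1), integral_const_mul,
      hcv (fun x ↦ u x * 𝓕 Φ.complexify x)] at h0
    simpa [hc, hc'] using h0
  have hterm : ∀ l : Fin (d i), |(pd r d ⟨i, l⟩)^[k] f (zs l)| ≤
      (1 / (2 * π)) ^ k * lam ^ ((2 * (i : ℕ) + 1) * k) * M * C ⟨i, l⟩ := fun l ↦ by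
    rw [← Real.norm_eq_abs, ← Complex.norm_real,
      iterate_pd_eq_of_comp_diagScaling r d ⟨i, l⟩ a ha hf hu huf k, norm_mul, norm_pow,
      Complex.norm_real, Real.norm_of_nonneg (by positivity : 0 ≤ a ⟨i, l⟩)]
    calc _ ≤ a ⟨i, l⟩ ^ k * (C ⟨i, l⟩ * M) := by gcongr; exact hbound _ _
      _ = _ := by simp only [a]; rw [div_pow, pow_mul, one_div, inv_pow]; ring
  have hblock : ∑ l : Fin (d i), C ⟨i, l⟩ ≤ ∑ l, C l := by
    rw [Fintype.sum_sigma]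
    exact Finset.single_le_sum (f := fun i ↦ ∑ l : Fin (d i), C ⟨i, l⟩)
      (fun i _ ↦ Finset.sum_nonneg fun l _ ↦ hC0 _) (Finset.mem_univ i)
  calc _ ≤ ∑ l : Fin (d i),
        (1 / (2 * π)) ^ k * lam ^ ((2 * (i : ℕ) + 1) * k) * M * C ⟨i, l⟩ :=
        Finset.sum_le_sum fun l _ ↦ hterm l
    _ = (1 / (2 * π)) ^ k * lam ^ ((2 * (i : ℕ) + 1) * k) * M * ∑ l : Fin (d i), C ⟨i, l⟩ := by
        rw [Finset.mul_sum]
    _ ≤ (1 / (2 * π)) ^ k * lam ^ ((2 * (i : ℕ) + 1) * k) * M * (∑ l, C l + 1) := by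
        gcongr
        linarith
    _ = _ := by ring
end
end

section
/- Geometric sum estimate over the interaction set: for every C_0 > 0, T > 0 and γ ∈ ℝ \ {0} there exists C > 0 (depending on C_0, T, γ, r) such that for all t ∈ [−T,T] and all j ∈ ℕ_0: Σ_{i ∈ Θ_j^t} 2^{−γ i} ≤ C 2^{−jγ} Σ_{0≤h≤k≤r} (|t| 4^j)^{|γ|(k−h)/(2h+1)}, where Θ_j^t := { i ∈ ℤ, i ≥ −1 : 2^i ≤ C_0 Σ_{0≤h≤k≤r} |t|^{(k−h)/(2h+1)} 2^{j(2k+1)/(2h+1)} and 2^j ≤ C_0 Σ_{0≤h≤k≤r} |t|^{(k−h)/(2h+1)} 2^{i(2k+1)/(2h+1)} }; moreover Σ_{i ∈ Θ_{−1}^t} 2^{−γ i} ≤ C, where Θ_{−1}^t := { i ∈ ℤ, i ≥ −1 : 2^i ≤ C_0 Σ_{0≤h≤k≤r} |t|^{(k−h)/(2h+1)} }. -/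
open Real Finset

noncomputable section

/-- The sum `Σ_{0 ≤ h ≤ k ≤ r} |t|^{(k−h)/(2h+1)} 2^{a(2k+1)/(2h+1)}` (with the convention
`|t|^0 = 1`). -/
def hkSum (r : ℕ) (t a : ℝ) : ℝ :=
  ∑ p : Fin (r+1) × Fin (r+1),
    if (p.2 : ℕ) ≤ (p.1 : ℕ) then
      |t| ^ ((((p.1 : ℕ) : ℝ) - ((p.2 : ℕ) : ℝ)) / (2 * ((p.2 : ℕ) : ℝ) + 1)) *
        (2:ℝ) ^ (a * (2 * ((p.1 : ℕ) : ℝ) + 1) / (2 * ((p.2 : ℕ) : ℝ) + 1))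
    else 0

theorem sum_zpow_le_of_lt_one {q B : ℝ} (hq0 : 0 < q) (hq1 : q < 1) (hB : 0 ≤ B)
    (S : Finset ℤ) (hS : ∀ i ∈ S, q ^ i ≤ B) : ∑ i ∈ S, q ^ i ≤ (1 - q)⁻¹ * B := by
  have h1q : 0 < 1 - q := by linarith
  rcases S.eq_empty_or_nonempty with rfl | hne
  · simpa using by positivity
  set m := S.min' hne
  have hm : ∀ i ∈ S, m ≤ i := fun i hi => S.min'_le i hi
  have hterm : ∀ i ∈ S, q ^ i = q ^ m * q ^ (i - m).toNat := by
    intro i hi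
    rw [← zpow_natCast, Int.toNat_of_nonneg (by linarith [hm i hi]), ← zpow_add₀ hq0.ne']
    congr 1
    ring
  have hinj : Set.InjOn (fun i : ℤ => (i - m).toNat) S := by
    intro a ha b hb hab
    have h1 := hm a ha
    have h2 := hm b hb
    simp only at hab
    omega
  calc ∑ i ∈ S, q ^ i = q ^ m * ∑ i ∈ S, q ^ (i - m).toNat := by
        rw [Finset.mul_sum]
        exact Finset.sum_congr rfl hterm
    _ = q ^ m * ∑ n ∈ S.image (fun i : ℤ => (i - m).toNat), q ^ n := by
        rw [Finset.sum_image hinj]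
    _ ≤ q ^ m * (1 - q)⁻¹ := by
        gcongr
        rw [← tsum_geometric_of_lt_one hq0.le hq1]
        exact (summable_geometric_of_lt_one hq0.le hq1).sum_le_tsum _
          fun n _ => pow_nonneg hq0.le n
    _ ≤ (1 - q)⁻¹ * B := by
        rw [mul_comm]
        gcongr
        exact hS m (S.min'_mem hne)

theorem sum_two_rpow_mul_le {c B : ℝ} (hc : c ≠ 0) (hB : 0 ≤ B)
    (S : Finset ℤ) (hS : ∀ i ∈ S, (2:ℝ) ^ (c * (i : ℝ)) ≤ B) :
    ∑ i ∈ S, (2:ℝ) ^ (c * (i : ℝ)) ≤ (1 - (2:ℝ) ^ (-|c|))⁻¹ * B := by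
  have hq0 : 0 < (2:ℝ) ^ (-|c|) := by positivity
  have hq1 : (2:ℝ) ^ (-|c|) < 1 :=
    Real.rpow_lt_one_of_one_lt_of_neg one_lt_two (by simpa using hc)
  rcases lt_or_gt_of_ne hc with h | h
  · have he : ∀ i : ℤ, (2:ℝ) ^ (c * (i : ℝ)) = ((2:ℝ) ^ (-|c|)) ^ i := by
      intro i
      rw [abs_of_neg h, neg_neg, Real.rpow_mul zero_le_two, Real.rpow_intCast]
    simp only [he] at hS ⊢
    exact sum_zpow_le_of_lt_one hq0 hq1 hB S hS
  · have he : ∀ i : ℤ, (2:ℝ) ^ (c * (i : ℝ)) = ((2:ℝ) ^ (-|c|)) ^ (-i) := by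
      intro i
      rw [abs_of_pos h, ← Real.rpow_intCast, ← Real.rpow_mul zero_le_two]
      push_cast
      ring_nf
    simp only [he] at hS ⊢
    have key := sum_zpow_le_of_lt_one hq0 hq1 hB (S.image Neg.neg) (by simpa using hS)
    rwa [Finset.sum_image neg_injective.injOn] at key

theorem rpow_sum_le_card_rpow_mul_sum_rpow {ι : Type*} (s : Finset ι) (a : ι → ℝ)
    (ha : ∀ i ∈ s, 0 ≤ a i) {g : ℝ} (hg : 0 < g) :
    (∑ i ∈ s, a i) ^ g ≤ (s.card : ℝ) ^ g * ∑ i ∈ s, a i ^ g := by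
  rcases s.eq_empty_or_nonempty with rfl | hne
  · simp [hg.ne']
  obtain ⟨m, hm, hmax⟩ := s.exists_max_image a hne
  calc (∑ i ∈ s, a i) ^ g ≤ (s.card * a m) ^ g := by
        refine Real.rpow_le_rpow (Finset.sum_nonneg ha) ?_ hg.le
        simpa using Finset.sum_le_card_nsmul s a (a m) hmax
    _ = (s.card : ℝ) ^ g * a m ^ g := Real.mul_rpow (by positivity) (ha m hm)
    _ ≤ (s.card : ℝ) ^ g * ∑ i ∈ s, a i ^ g := by
        gcongr
        exact Finset.single_le_sum (f := fun i => a i ^ g)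
          (fun i hi => Real.rpow_nonneg (ha i hi) g) hm

/-- The sum `Σ_{0 ≤ h ≤ k ≤ r} x^{g(k−h)/(2h+1)}`. -/
def hkPowerSum (r : ℕ) (g x : ℝ) : ℝ :=
  ∑ p : Fin (r+1) × Fin (r+1),
    if (p.2 : ℕ) ≤ (p.1 : ℕ) then
      x ^ (g * (((p.1 : ℕ) : ℝ) - ((p.2 : ℕ) : ℝ)) / (2 * ((p.2 : ℕ) : ℝ) + 1))
    else 0

theorem hkSum_eq_two_rpow_mul_hkPowerSum (r : ℕ) (t a : ℝ) :
    hkSum r t a = (2:ℝ) ^ a * hkPowerSum r 1 (|t| * (4:ℝ) ^ a) := by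
  unfold hkSum hkPowerSum
  rw [Finset.mul_sum]
  refine Finset.sum_congr rfl fun p _ => ?_
  split_ifs with h
  · have h4 : (4:ℝ) = 2 ^ (2:ℝ) := by norm_num
    rw [Real.mul_rpow (abs_nonneg t) (by positivity), h4, ← Real.rpow_mul zero_le_two,
      ← Real.rpow_mul zero_le_two, mul_left_comm, ← Real.rpow_add zero_lt_two, one_mul]
    congr 2
    field_simp
    ring
  · simp

theorem hkPowerSum_mono (r : ℕ) {g x y : ℝ} (hg : 0 ≤ g) (hx : 0 ≤ x) (hxy : x ≤ y) :
    hkPowerSum r g x ≤ hkPowerSum r g y := by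
  refine Finset.sum_le_sum fun p _ => ?_
  split_ifs with h
  · have h' : ((p.2 : ℕ) : ℝ) ≤ ((p.1 : ℕ) : ℝ) := by exact_mod_cast h
    refine Real.rpow_le_rpow hx hxy (div_nonneg (mul_nonneg hg (by linarith)) (by positivity))
  · exact le_rfl

theorem one_le_hkPowerSum (r : ℕ) (g : ℝ) {x : ℝ} (hx : 0 ≤ x) : 1 ≤ hkPowerSum r g x := by
  have h := Finset.single_le_sum (s := Finset.univ)
    (f := fun p : Fin (r+1) × Fin (r+1) => if (p.2 : ℕ) ≤ (p.1 : ℕ) then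
      x ^ (g * (((p.1 : ℕ) : ℝ) - ((p.2 : ℕ) : ℝ)) / (2 * ((p.2 : ℕ) : ℝ) + 1)) else 0)
    (fun p _ => by
      split_ifs
      · exact Real.rpow_nonneg hx _
      · exact le_rfl) (Finset.mem_univ (0, 0))
  simpa [hkPowerSum] using h

theorem hkPowerSum_one_rpow_le (r : ℕ) {g x : ℝ} (hg : 0 < g) (hx : 0 ≤ x) :
    hkPowerSum r 1 x ^ g ≤
      ((Finset.univ : Finset (Fin (r+1) × Fin (r+1))).card : ℝ) ^ g * hkPowerSum r g x := by
  refine (rpow_sum_le_card_rpow_mul_sum_rpow Finset.univ _ (fun p _ => ?_) hg).trans_eq ?_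
  · split_ifs
    · exact Real.rpow_nonneg hx _
    · exact le_rfl
  · congr 1
    refine Finset.sum_congr rfl fun p _ => ?_
    split_ifs
    · rw [← Real.rpow_mul hx]
      congr 1
      ring
    · exact Real.zero_rpow hg.ne'

theorem two_rpow_neg_le_of_two_rpow_le_hkSum {r : ℕ} {C₀ t i j : ℝ} (hC₀ : 0 < C₀)
    (h : (2:ℝ) ^ j ≤ C₀ * hkSum r t i) :
    (2:ℝ) ^ (-i) ≤ max C₀ 1 * ((2:ℝ) ^ (-j) * hkPowerSum r 1 (|t| * (4:ℝ) ^ j)) := by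
  have hF := one_le_hkPowerSum r 1 (x := |t| * (4:ℝ) ^ j) (by positivity)
  rcases le_total i j with hij | hij
  · have hmono : hkPowerSum r 1 (|t| * (4:ℝ) ^ i) ≤ hkPowerSum r 1 (|t| * (4:ℝ) ^ j) :=
      hkPowerSum_mono r zero_le_one (by positivity) (by gcongr; norm_num)
    rw [hkSum_eq_two_rpow_mul_hkPowerSum] at h
    have hi : (0:ℝ) < 2 ^ i := by positivity
    have hj : (0:ℝ) < 2 ^ j := by positivity
    calc (2:ℝ) ^ (-i) = 2 ^ j * (2 ^ (-i) * 2 ^ (-j)) := by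
          rw [Real.rpow_neg zero_le_two, Real.rpow_neg zero_le_two]
          field_simp
      _ ≤ (C₀ * (2 ^ i * hkPowerSum r 1 (|t| * (4:ℝ) ^ i))) * (2 ^ (-i) * 2 ^ (-j)) := by
          gcongr
      _ = C₀ * (2 ^ (-j) * hkPowerSum r 1 (|t| * (4:ℝ) ^ i)) := by
          rw [Real.rpow_neg zero_le_two i]
          field_simp
      _ ≤ _ := mul_le_mul (le_max_left C₀ 1) (by gcongr) (by
          have := one_le_hkPowerSum r 1 (x := |t| * (4:ℝ) ^ i) (by positivity)
          positivity) (by positivity)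
  · calc (2:ℝ) ^ (-i) ≤ 2 ^ (-j) := by gcongr; norm_num
      _ = 1 * (2 ^ (-j) * 1) := by ring
      _ ≤ _ := by
          gcongr
          exact le_max_right _ _

theorem two_rpow_neg_mul_le_hkPowerSum {r : ℕ} {C₀ γ t i j : ℝ} (hC₀ : 0 < C₀) (hγ : γ ≠ 0)
    (hi : (2:ℝ) ^ i ≤ C₀ * hkSum r t j) (hj : (2:ℝ) ^ j ≤ C₀ * hkSum r t i) :
    (2:ℝ) ^ (-γ * i) ≤ max C₀ 1 ^ |γ| *
      ((2:ℝ) ^ (-j * γ) * hkPowerSum r 1 (|t| * (4:ℝ) ^ j) ^ |γ|) := by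
  have hF : 0 ≤ hkPowerSum r 1 (|t| * (4:ℝ) ^ j) :=
    zero_le_one.trans (one_le_hkPowerSum r 1 (by positivity))
  have hmax : 0 ≤ max C₀ 1 := by positivity
  rcases lt_or_gt_of_ne hγ with h | h
  · rw [hkSum_eq_two_rpow_mul_hkPowerSum] at hi
    have hi' : (2:ℝ) ^ i ≤ max C₀ 1 * (2 ^ j * hkPowerSum r 1 (|t| * (4:ℝ) ^ j)) :=
      by
      refine hi.trans ?_
      gcongr
      exact le_max_left _ _
    have key := Real.rpow_le_rpow (by positivity) hi' (abs_nonneg γ)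
    rw [Real.mul_rpow hmax (by positivity), Real.mul_rpow (by positivity) hF,
      ← Real.rpow_mul zero_le_two, ← Real.rpow_mul zero_le_two] at key
    rw [abs_of_neg h] at key ⊢
    convert key using 2
    · ring
    · ring_nf
  · have key := Real.rpow_le_rpow (by positivity)
      (two_rpow_neg_le_of_two_rpow_le_hkSum hC₀ hj) (abs_nonneg γ)
    rw [Real.mul_rpow hmax (by positivity), Real.mul_rpow (by positivity) hF,
      ← Real.rpow_mul zero_le_two, ← Real.rpow_mul zero_le_two] at key
    rw [abs_of_pos h] at key ⊢
    convert key using 2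
    ring

theorem two_rpow_neg_mul_le_of_le {γ i M : ℝ} (hM : 0 ≤ M) (hi : -1 ≤ i) (hiM : (2:ℝ) ^ i ≤ M) :
    (2:ℝ) ^ (-γ * i) ≤ M ^ |γ| + 2 ^ |γ| := by
  rcases le_total γ 0 with h | h
  · have key := Real.rpow_le_rpow (by positivity) hiM (abs_nonneg γ)
    rw [← Real.rpow_mul zero_le_two, abs_of_nonpos h, mul_comm] at key
    rw [abs_of_nonpos h]
    have : (0:ℝ) ≤ 2 ^ (-γ) := by positivity
    linarith
  · have key : (2:ℝ) ^ (-γ * i) ≤ 2 ^ |γ| := by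
      apply Real.rpow_le_rpow_of_exponent_le one_le_two
      rw [abs_of_nonneg h]
      nlinarith
    have : 0 ≤ M ^ |γ| := by positivity
    linarith

/-- **Geometric sum estimate over the interaction set.**
Sums over the (finite) sets `Θ_j^t` and `Θ_{−1}^t` are expressed through arbitrary finite
subsets of integers satisfying the defining membership conditions. -/
theorem geometric_sum_over_interaction_set
    (r : ℕ) (C₀ : ℝ) (hC₀ : 0 < C₀) (T : ℝ) (hT : 0 < T) (γ : ℝ) (hγ : γ ≠ 0) :
    ∃ C > (0:ℝ), ∀ t : ℝ, |t| ≤ T →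
      (∀ j : ℕ, ∀ S : Finset ℤ,
        (∀ i ∈ S, (-1 : ℤ) ≤ i ∧
          (2:ℝ) ^ ((i : ℝ)) ≤ C₀ * hkSum r t (j : ℝ) ∧
          (2:ℝ) ^ ((j : ℝ)) ≤ C₀ * hkSum r t (i : ℝ)) →
        ∑ i ∈ S, (2:ℝ) ^ (-γ * (i : ℝ))
          ≤ C * (2:ℝ) ^ (-(j : ℝ) * γ) *
            ∑ p : Fin (r+1) × Fin (r+1),
              if (p.2 : ℕ) ≤ (p.1 : ℕ) then
                (|t| * (4:ℝ) ^ (j : ℕ)) ^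
                  (|γ| * (((p.1 : ℕ) : ℝ) - ((p.2 : ℕ) : ℝ)) / (2 * ((p.2 : ℕ) : ℝ) + 1))
              else 0) ∧
      (∀ S : Finset ℤ,
        (∀ i ∈ S, (-1 : ℤ) ≤ i ∧ (2:ℝ) ^ ((i : ℝ)) ≤ C₀ * hkSum r t 0) →
        ∑ i ∈ S, (2:ℝ) ^ (-γ * (i : ℝ)) ≤ C) := by
  have hg : 0 < |γ| := abs_pos.mpr hγ
  have hc : -γ ≠ 0 := neg_ne_zero.mpr hγ
  set K : ℝ := (1 - (2:ℝ) ^ (-|-γ|))⁻¹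
  have hK : 0 < K := by
    have : (2:ℝ) ^ (-|-γ|) < 1 :=
      Real.rpow_lt_one_of_one_lt_of_neg one_lt_two (by simpa using hγ)
    exact inv_pos.mpr (by linarith)
  set N : ℝ := ((Finset.univ : Finset (Fin (r+1) × Fin (r+1))).card : ℝ) ^ |γ|
  have hN : 0 ≤ N := by positivity
  set A : ℝ := max C₀ 1 ^ |γ|
  have hA : 0 ≤ A := by positivity
  set M : ℝ := C₀ * hkPowerSum r 1 T
  have hM : 0 ≤ M := by
    have := one_le_hkPowerSum r 1 hT.le
    positivity
  refine ⟨K * (A * N) + K * (M ^ |γ| + 2 ^ |γ|), by positivity, fun t ht => ⟨?_, ?_⟩⟩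
  · intro j S hS
    change _ ≤ _ * hkPowerSum r |γ| (|t| * (4:ℝ) ^ j)
    have hx : 0 ≤ |t| * (4:ℝ) ^ j := by positivity
    have hF := zero_le_one.trans (one_le_hkPowerSum r |γ| hx)
    have hB : ∀ i ∈ S, (2:ℝ) ^ (-γ * (i : ℝ)) ≤
        A * ((2:ℝ) ^ (-(j : ℝ) * γ) * (N * hkPowerSum r |γ| (|t| * (4:ℝ) ^ j))) := by
      intro i hi
      obtain ⟨-, h1, h2⟩ := hS i hi
      refine (two_rpow_neg_mul_le_hkPowerSum hC₀ hγ h1 h2).trans ?_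
      rw [Real.rpow_natCast]
      gcongr
      exact hkPowerSum_one_rpow_le r hg hx
    refine (sum_two_rpow_mul_le hc (by positivity) S hB).trans ?_
    calc K * (A * ((2:ℝ) ^ (-(j : ℝ) * γ) * (N * hkPowerSum r |γ| (|t| * (4:ℝ) ^ j))))
        = K * (A * N) * (2:ℝ) ^ (-(j : ℝ) * γ) * hkPowerSum r |γ| (|t| * (4:ℝ) ^ j) := by ring
      _ ≤ _ := by
        gcongr
        exact le_add_of_nonneg_right (by positivity)
  · intro S hS
    have hB : ∀ i ∈ S, (2:ℝ) ^ (-γ * (i : ℝ)) ≤ M ^ |γ| + 2 ^ |γ| := by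
      intro i hi
      obtain ⟨h1, h2⟩ := hS i hi
      refine two_rpow_neg_mul_le_of_le hM (by exact_mod_cast h1) (h2.trans ?_)
      rw [hkSum_eq_two_rpow_mul_hkPowerSum, Real.rpow_zero, Real.rpow_zero, one_mul, mul_one]
      exact mul_le_mul_of_nonneg_left
        (hkPowerSum_mono r zero_le_one (abs_nonneg t) ht) hC₀.le
    refine (sum_two_rpow_mul_le hc (by positivity) S hB).trans ?_
    exact le_add_of_nonneg_left (by positivity)
end
end
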